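/- Let 2 ≤ N < q and let 0 < α < α_N := N·ω_{N-1}^{1/(N-1)}. Then there exists a constant C = C(N,α,q) > 0 such that for every function u ∈ L^q(ℝ^N) ∩ W^{1,N}(ℝ^N) with ∫_{ℝ^N}|∇u|^N dx ≤ 1, one has ∫_{ℝ^N} e^{α|u(x)|^{N/(N-1)}} |u(x)|^q dx ≤ C ∫_{ℝ^N} |u(x)|^q dx. -/

import Mathlib

open MeasureTheory Real

/-- Surface area of the unit sphere `S^{N-1}` in `ℝ^N`, i.e. `ω_{N-1} = N · vol(B(0,1))`. -/
noncomputable def sphereArea (N : ℕ) : ℝ :=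
  N * (volume (Metric.ball (0 : EuclideanSpace ℝ (Fin N)) 1)).toReal

/-- `Φ_N(τ) = Σ_{j ≥ N-1} τ^j / j!`, the exponential series with the first `N-1` terms removed. -/
noncomputable def PhiN (N : ℕ) (τ : ℝ) : ℝ :=
  ∑' j : ℕ, τ ^ (j + (N - 1)) / (Nat.factorial (j + (N - 1)) : ℝ)

/-- `g` is the weak gradient of `u` on `ℝ^N`: both are locally integrable and the
integration-by-parts identity holds against all smooth compactly supported test functions. -/
def HasWeakGradient {N : ℕ} (u : EuclideanSpace ℝ (Fin N) → ℝ)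
    (g : EuclideanSpace ℝ (Fin N) → EuclideanSpace ℝ (Fin N)) : Prop :=
  LocallyIntegrable u volume ∧ LocallyIntegrable g volume ∧
  ∀ φ : EuclideanSpace ℝ (Fin N) → ℝ, ContDiff ℝ (⊤ : ℕ∞) φ → HasCompactSupport φ →
    ∀ i : Fin N,
      ∫ x, u x * fderiv ℝ φ x (EuclideanSpace.single i 1) = - ∫ x, g x i * φ x

open scoped ENNReal NNReal Convolution
open Set Filter Topology

section Integrals

/-- Jensen's inequality for the (unnormalized) weight `K`. -/
theorem rpow_lintegral_mul_le {X : Type*} [MeasurableSpace X] {μ : Measure X} {p : ℝ}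
    (hp : 1 < p) {K F : X → ℝ≥0∞} (hK : AEMeasurable K μ) (hF : AEMeasurable F μ) :
    (∫⁻ x, K x * F x ∂μ) ^ p ≤ (∫⁻ x, K x ∂μ) ^ (p - 1) * ∫⁻ x, K x * F x ^ p ∂μ := by
  have hp0 : 0 < p := by linarith
  have hpq := Real.HolderConjugate.conjExponent hp
  set q := p.conjExponent
  have hq0 : 0 < q := hpq.symm.pos
  have h1 := ENNReal.lintegral_mul_le_Lp_mul_Lq μ hpq.symm
    (f := fun x => K x ^ (1 / q)) (g := fun x => K x ^ (1 / p) * F x)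
    (hK.pow_const _) ((hK.pow_const _).mul hF)
  have e1 : ∀ x, ((fun x => K x ^ (1 / q)) * fun x => K x ^ (1 / p) * F x) x = K x * F x := by
    intro x
    simp only [Pi.mul_apply]
    rw [← mul_assoc, ← ENNReal.rpow_add_of_nonneg _ _ (by positivity) (by positivity)]
    have : 1 / q + 1 / p = 1 := by simpa using hpq.symm.inv_add_inv_eq_one
    rw [this, ENNReal.rpow_one]
  have e2 : ∀ x, (K x ^ (1 / q)) ^ q = K x := by
    intro x
    rw [← ENNReal.rpow_mul, one_div_mul_cancel hq0.ne', ENNReal.rpow_one]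
  have e3 : ∀ x, (K x ^ (1 / p) * F x) ^ p = K x * F x ^ p := by
    intro x
    rw [ENNReal.mul_rpow_of_nonneg _ _ hp0.le, ← ENNReal.rpow_mul, one_div_mul_cancel hp0.ne',
      ENNReal.rpow_one]
  simp only [e1, e2, e3] at h1
  refine (ENNReal.rpow_le_rpow h1 hp0.le).trans (le_of_eq ?_)
  rw [ENNReal.mul_rpow_of_nonneg _ _ hp0.le, ← ENNReal.rpow_mul, ← ENNReal.rpow_mul,
    one_div_mul_cancel hp0.ne', ENNReal.rpow_one]
  congr 2
  have := hpq.symm.sub_one_mul_conj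
  have h2 := hpq.sub_one_mul_conj
  field_simp
  linarith

/-- Young's convolution inequality `‖K ⋆ F‖_p ≤ ‖K‖_1 ‖F‖_p` for nonnegative functions. -/
theorem lintegral_rpow_lintegral_sub_mul_le {E : Type*} [NormedAddCommGroup E]
    [MeasurableSpace E] [BorelSpace E] [SecondCountableTopology E] {μ : Measure E} [SFinite μ]
    [μ.IsAddLeftInvariant] [μ.IsNegInvariant]
    {p : ℝ} (hp : 1 < p) {K F : E → ℝ≥0∞} (hK : Measurable K) (hF : AEMeasurable F μ) :
    ∫⁻ x, (∫⁻ y, K (x - y) * F y ∂μ) ^ p ∂μ ≤ (∫⁻ x, K x ∂μ) ^ p * ∫⁻ x, F x ^ p ∂μ := by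
  have hKx : ∀ x, ∫⁻ y, K (x - y) ∂μ = ∫⁻ y, K y ∂μ := fun x => lintegral_sub_left_eq_self K x
  have hKy : ∀ y, ∫⁻ x, K (x - y) ∂μ = ∫⁻ y, K y ∂μ := fun y => lintegral_sub_right_eq_self K y
  calc ∫⁻ x, (∫⁻ y, K (x - y) * F y ∂μ) ^ p ∂μ
      ≤ ∫⁻ x, (∫⁻ y, K y ∂μ) ^ (p - 1) * ∫⁻ y, K (x - y) * F y ^ p ∂μ ∂μ := by
        refine lintegral_mono fun x => ?_
        have := rpow_lintegral_mul_le (μ := μ) hp (K := fun y => K (x - y)) (F := F)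
          (by fun_prop) hF
        rwa [hKx] at this
    _ = (∫⁻ y, K y ∂μ) ^ (p - 1) * ∫⁻ x, ∫⁻ y, K (x - y) * F y ^ p ∂μ ∂μ := by
        refine lintegral_const_mul'' _ ?_
        refine AEMeasurable.lintegral_prod_right' (f := fun z : E × E => K (z.1 - z.2) * F z.2 ^ p) ?_
        exact (hK.comp (measurable_fst.sub measurable_snd)).aemeasurable.mul
          ((hF.comp_snd).pow_const _)
    _ = (∫⁻ y, K y ∂μ) ^ (p - 1) * ∫⁻ y, ∫⁻ x, K (x - y) * F y ^ p ∂μ ∂μ := by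
        rw [lintegral_lintegral_swap]
        exact (hK.comp (measurable_fst.sub measurable_snd)).aemeasurable.mul
          ((hF.comp_snd).pow_const _)
    _ = (∫⁻ y, K y ∂μ) ^ (p - 1) * ∫⁻ y, (∫⁻ x, K x ∂μ) * F y ^ p ∂μ := by
        congr 2 with y
        rw [lintegral_mul_const _ (by fun_prop), hKy]
    _ = (∫⁻ x, K x ∂μ) ^ p * ∫⁻ x, F x ^ p ∂μ := by
        rw [lintegral_const_mul'' _ (hF.pow_const _), ← mul_assoc]
        congr 1
        conv_lhs => rw [← ENNReal.rpow_one (∫⁻ x, K x ∂μ), ← ENNReal.rpow_mul]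
        rw [← ENNReal.rpow_add_of_nonneg _ _ (by linarith) (by linarith)]
        congr 1; ring

end Integrals

section Polar

variable {E : Type*} [NormedAddCommGroup E] [NormedSpace ℝ E] [FiniteDimensional ℝ E]
  [MeasurableSpace E] [BorelSpace E] [Nontrivial E] (μ : Measure E) [μ.IsAddHaarMeasure]

theorem lintegral_eq_lintegral_toSphere {F : E → ℝ≥0∞} (hF : Measurable F) :
    ∫⁻ x, F x ∂μ = ∫⁻ θ : Metric.sphere (0 : E) 1, (∫⁻ r in Ioi (0 : ℝ),
      ENNReal.ofReal (r ^ (Module.finrank ℝ E - 1)) * F (r • (θ : E))) ∂μ.toSphere := by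
  have h0 : ∫⁻ x, F x ∂μ = ∫⁻ x : ({0}ᶜ : Set E), F x ∂(μ.comap (↑)) := by
    rw [lintegral_subtype_comap (measurableSet_singleton _).compl, restrict_compl_singleton]
  rw [h0]
  have hmp := μ.measurePreserving_homeomorphUnitSphereProd
  have h1 := hmp.lintegral_comp_emb (Homeomorph.measurableEmbedding _)
    (fun z : Metric.sphere (0 : E) 1 × Ioi (0 : ℝ) => F ((z.2 : ℝ) • (z.1 : E)))
  have h2 : ∀ x : ({0}ᶜ : Set E), F ((((homeomorphUnitSphereProd E) x).2 : ℝ) •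
      (((homeomorphUnitSphereProd E) x).1 : E)) = F x := by
    intro x
    have hx : ‖(x : E)‖ ≠ 0 := norm_ne_zero_iff.2 x.2
    simp [smul_smul, hx]
  simp only [h2] at h1
  rw [h1, lintegral_prod]
  · refine lintegral_congr fun θ => ?_
    rw [Measure.volumeIoiPow, lintegral_withDensity_eq_lintegral_mul]
    · rw [← lintegral_subtype_comap measurableSet_Ioi]
      rfl
    · fun_prop
    · fun_prop
  · apply Measurable.aemeasurable
    fun_prop

theorem lintegral_norm_eq {f : ℝ → ℝ≥0∞} (hf : Measurable f) :
    ∫⁻ x, f ‖x‖ ∂μ = Module.finrank ℝ E * μ (Metric.ball 0 1) * ∫⁻ r in Ioi (0 : ℝ),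
      ENNReal.ofReal (r ^ (Module.finrank ℝ E - 1)) * f r := by
  rw [lintegral_eq_lintegral_toSphere μ (F := fun x => f ‖x‖) (by fun_prop)]
  have : ∀ θ : Metric.sphere (0 : E) 1, ∫⁻ r in Ioi (0 : ℝ),
      ENNReal.ofReal (r ^ (Module.finrank ℝ E - 1)) * f ‖r • (θ : E)‖ =
      ∫⁻ r in Ioi (0 : ℝ), ENNReal.ofReal (r ^ (Module.finrank ℝ E - 1)) * f r := by
    intro θ
    refine setLIntegral_congr_fun measurableSet_Ioi fun r hr => ?_
    simp [norm_smul, abs_of_pos (mem_Ioi.1 hr)]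
  simp only [this, lintegral_const, Measure.toSphere_apply_univ]
  rw [mul_comm]


theorem lintegral_indicator_ball_inv_norm_pow (δ : ℝ) :
    ∫⁻ x, (Iio δ).indicator
      (fun r => ENNReal.ofReal ((r ^ (Module.finrank ℝ E - 1))⁻¹)) ‖x‖ ∂μ =
      Module.finrank ℝ E * μ (Metric.ball 0 1) * ENNReal.ofReal δ := by
  rw [lintegral_norm_eq μ (Measurable.indicator (by fun_prop) measurableSet_Iio)]
  congr 1
  have : ∀ r ∈ Ioi (0 : ℝ), ENNReal.ofReal (r ^ (Module.finrank ℝ E - 1)) *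
      (Iio δ).indicator (fun r => ENNReal.ofReal ((r ^ (Module.finrank ℝ E - 1))⁻¹)) r =
      (Iio δ).indicator (fun _ => 1) r := by
    intro r hr
    by_cases h : r ∈ Iio δ
    · simp only [indicator_of_mem h]
      rw [← ENNReal.ofReal_mul (pow_nonneg (mem_Ioi.1 hr).le _),
        mul_inv_cancel₀ (pow_ne_zero _ (mem_Ioi.1 hr).ne'), ENNReal.ofReal_one]
    · simp [indicator_of_notMem h]
  rw [setLIntegral_congr_fun measurableSet_Ioi this, lintegral_indicator measurableSet_Iio,
    setLIntegral_one, Measure.restrict_apply measurableSet_Iio, inter_comm, Ioi_inter_Iio,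
    Real.volume_Ioo, sub_zero]

theorem lintegral_indicator_annulus_inv_norm_pow {δ R : ℝ} (hδ : 0 < δ) (hR : δ ≤ R) :
    ∫⁻ x, (Ico δ R).indicator
      (fun r => ENNReal.ofReal ((r ^ Module.finrank ℝ E)⁻¹)) ‖x‖ ∂μ =
      Module.finrank ℝ E * μ (Metric.ball 0 1) * ENNReal.ofReal (log (R / δ)) := by
  rw [lintegral_norm_eq μ (Measurable.indicator (by fun_prop) measurableSet_Ico)]
  congr 1
  have hd : 0 < Module.finrank ℝ E := Module.finrank_pos
  have : ∀ r ∈ Ioi (0 : ℝ), ENNReal.ofReal (r ^ (Module.finrank ℝ E - 1)) *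
      (Ico δ R).indicator (fun r => ENNReal.ofReal ((r ^ Module.finrank ℝ E)⁻¹)) r =
      (Ico δ R).indicator (fun r => ENNReal.ofReal r⁻¹) r := by
    intro r hr
    by_cases h : r ∈ Ico δ R
    · simp only [indicator_of_mem h]
      rw [← ENNReal.ofReal_mul (pow_nonneg (mem_Ioi.1 hr).le _)]
      obtain ⟨k, hk⟩ := Nat.exists_eq_succ_of_ne_zero hd.ne'
      have hr0 : r ≠ 0 := (mem_Ioi.1 hr).ne'
      congr 1
      rw [hk, Nat.succ_sub_one, pow_succ]
      field_simp
    · simp [indicator_of_notMem h]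
  rw [setLIntegral_congr_fun measurableSet_Ioi this, lintegral_indicator measurableSet_Ico,
    Measure.restrict_restrict measurableSet_Ico,
    inter_eq_left.2 fun r hr => mem_Ioi.2 (hδ.trans_le hr.1),
    restrict_Ico_eq_restrict_Ioc, ← ofReal_integral_eq_lintegral_ofReal,
    ← intervalIntegral.integral_of_le hR, integral_inv_of_pos hδ (hδ.trans_le hR)]
  · refine (intervalIntegrable_iff_integrableOn_Ioc_of_le hR).1 (intervalIntegrable_inv_iff.2 ?_)
    right
    rw [uIcc_of_le hR]
    exact fun h => absurd h.1 (not_le.2 hδ)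
  · refine (ae_restrict_mem measurableSet_Ioc).mono fun r hr => ?_
    exact inv_nonneg.2 (hδ.trans hr.1).le

/-- The pointwise bound of a function by the Riesz potential of its gradient. -/
theorem mul_enorm_le_lintegral_enorm_fderiv {w : E → ℝ} (hw : ContDiff ℝ 1 w)
    (hc : HasCompactSupport w) (x : E) :
    Module.finrank ℝ E * μ (Metric.ball 0 1) * ‖w x‖ₑ ≤
      ∫⁻ y, ENNReal.ofReal ((‖x - y‖ ^ (Module.finrank ℝ E - 1))⁻¹) * ‖fderiv ℝ w y‖ₑ ∂μ := by
  have hcont : Continuous fun y => ‖fderiv ℝ w y‖ₑ := (hw.continuous_fderiv one_ne_zero).enorm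
  rw [← lintegral_sub_left_eq_self _ x,
    lintegral_eq_lintegral_toSphere μ (by have := hcont.measurable; fun_prop)]
  rw [← Measure.toSphere_apply_univ, mul_comm, ← lintegral_const]
  refine lintegral_mono fun θ => ?_
  have hθ : ‖(θ : E)‖ = 1 := by simp
  set γ : ℝ → E := fun r => x - r • (θ : E) with hγ
  have hγd : ∀ r, HasDerivAt γ (-(θ : E)) r := fun r => by
    simpa using ((hasDerivAt_id r).smul_const (θ : E)).const_sub x
  have hγs : ContDiff ℝ 1 γ := by fun_prop
  have hiso : Isometry γ := Isometry.of_dist_eq fun a b => by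
    rw [dist_eq_norm, dist_eq_norm]
    have : γ a - γ b = (b - a) • (θ : E) := by simp only [hγ]; module
    rw [this, norm_smul, hθ, mul_one, norm_sub_rev]
  have hcs : HasCompactSupport (w ∘ γ) := hc.comp_isClosedEmbedding hiso.isClosedEmbedding
  have h1 := hcs.integral_Ioi_deriv_eq (hw.comp hγs) 0
  have hderiv : ∀ r, deriv (w ∘ γ) r = fderiv ℝ w (γ r) (-(θ : E)) := fun r =>
    (((hw.differentiable one_ne_zero).differentiableAt.hasFDerivAt).comp_hasDerivAt r (hγd r)).deriv
  have h2 : ‖w x‖ₑ ≤ ∫⁻ r in Ioi (0 : ℝ), ‖deriv (w ∘ γ) r‖ₑ := by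
    have h3 := enorm_integral_le_lintegral_enorm (μ := volume.restrict (Ioi (0 : ℝ)))
      (deriv (w ∘ γ))
    rw [h1] at h3
    simpa [hγ] using h3
  refine h2.trans (setLIntegral_mono' measurableSet_Ioi fun r hr => ?_)
  have hr0 : (0 : ℝ) < r := hr
  have h4 : ‖x - (x - r • (θ : E))‖ = r := by
    rw [sub_sub_cancel, norm_smul, hθ, mul_one, Real.norm_of_nonneg hr0.le]
  rw [h4, ← mul_assoc, ← ENNReal.ofReal_mul (by positivity),
    mul_inv_cancel₀ (by positivity), ENNReal.ofReal_one, one_mul, hderiv]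
  have h5 := (fderiv ℝ w (γ r)).le_opENorm (-(θ : E))
  have h6 : ‖-(θ : E)‖ₑ = 1 := by rw [enorm_neg, ← ofReal_norm, hθ, ENNReal.ofReal_one]
  rwa [h6, mul_one] at h5

/-- A sharp level set estimate for functions whose gradient is supported in `Ω`. -/
theorem measure_le_abs_le (hd : 2 ≤ Module.finrank ℝ E) {w : E → ℝ} (hw : ContDiff ℝ 1 w)
    (hc : HasCompactSupport w) {Ω : Set E} (hΩ : MeasurableSet Ω)
    (hsupp : ∀ y ∉ Ω, fderiv ℝ w y = 0)
    (hgrad : ∫⁻ y, ‖fderiv ℝ w y‖ₑ ^ (Module.finrank ℝ E : ℝ) ∂μ ≤ 1)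
    {R δ : ℝ} (hδ : 0 < δ) (hδR : δ ≤ R) (hR : μ Ω ≤ ENNReal.ofReal (R ^ Module.finrank ℝ E))
    {ω : ℝ} (hω : 0 < ω)
    (hωμ : Module.finrank ℝ E * μ (Metric.ball 0 1) = ENNReal.ofReal ω) :
    μ {x | 1 + (ω * log (R / δ) + 1) ^ (((Module.finrank ℝ E : ℝ) - 1) / Module.finrank ℝ E) / ω
      ≤ |w x|} ≤ ENNReal.ofReal (δ ^ Module.finrank ℝ E) := by
  set d := Module.finrank ℝ E with hdef
  have hd2 : (2 : ℝ) ≤ d := by exact_mod_cast hd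
  have hR0 : 0 < R := hδ.trans_le hδR
  have hlog : 0 ≤ log (R / δ) := log_nonneg ((one_le_div hδ).2 hδR)
  set A : ℝ := (ω * log (R / δ) + 1) ^ (((d : ℝ) - 1) / d) with hA
  have hA0 : 0 ≤ A := by positivity
  set f : E → ℝ≥0∞ := fun y => ‖fderiv ℝ w y‖ₑ with hf
  have hfm : Measurable f := (hw.continuous_fderiv one_ne_zero).enorm.measurable
  set k : ℝ → ℝ≥0∞ := fun r => ENNReal.ofReal ((r ^ (d - 1))⁻¹) with hk
  have hkm : Measurable k := by fun_prop
  set K₁ : E → ℝ≥0∞ := fun z => (Iio δ).indicator k ‖z‖ with hK₁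
  have hK₁m : Measurable K₁ := (hkm.indicator measurableSet_Iio).comp measurable_norm
  set K₂ : E → ℝ≥0∞ := fun z => (Ici δ).indicator k ‖z‖ with hK₂
  have hK₂m : Measurable K₂ := (hkm.indicator measurableSet_Ici).comp measurable_norm
  set I : E → ℝ≥0∞ := fun x => ∫⁻ y, K₁ (x - y) * f y ∂μ with hI
  have hIm : Measurable I := by
    refine Measurable.lintegral_prod_right' (f := fun z : E × E => K₁ (z.1 - z.2) * f z.2) ?_
    fun_prop
  have hfar : ∀ x, ∫⁻ y, K₂ (x - y) * f y ∂μ ≤ ENNReal.ofReal A := by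
    intro x
    have h1 : ∫⁻ y, K₂ (x - y) * f y ∂μ = ∫⁻ y in Ω, K₂ (x - y) * f y ∂μ := by
      rw [← lintegral_indicator hΩ]
      refine lintegral_congr fun y => ?_
      by_cases hy : y ∈ Ω
      · rw [indicator_of_mem hy]
      · rw [indicator_of_notMem hy]
        have hf0 : f y = 0 := by
          change ‖fderiv ℝ w y‖ₑ = 0
          rw [← ofReal_norm, hsupp y hy, norm_zero, ENNReal.ofReal_zero]
        rw [hf0, mul_zero]
    have hpq : ((d : ℝ) / (d - 1)).HolderConjugate d := by
      have := Real.HolderConjugate.conjExponent (p := (d : ℝ)) (by linarith)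
      exact this.symm
    have h2 := ENNReal.lintegral_mul_le_Lp_mul_Lq (μ.restrict Ω) hpq
      (f := fun y => K₂ (x - y)) (g := f) (by fun_prop) hfm.aemeasurable
    have h3 : (∫⁻ y in Ω, f y ^ (d : ℝ) ∂μ) ^ (1 / (d : ℝ)) ≤ 1 := by
      refine ENNReal.rpow_le_one ((setLIntegral_le_lintegral _ _).trans hgrad) (by positivity)
    have h4 : ∫⁻ y in Ω, K₂ (x - y) ^ ((d : ℝ) / (d - 1)) ∂μ ≤
        ENNReal.ofReal (ω * log (R / δ) + 1) := by
      set k' : ℝ → ℝ≥0∞ := fun r => ENNReal.ofReal ((r ^ d)⁻¹) with hk'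
      have hk'm : Measurable k' := by fun_prop
      have h5 : ∀ z, K₂ z ^ ((d : ℝ) / (d - 1)) ≤
          (Ico δ R).indicator k' ‖z‖ + ENNReal.ofReal ((R ^ d)⁻¹) := by
        intro z
        have hdp : 0 < (d : ℝ) / (d - 1) := div_pos (by linarith) (by linarith)
        by_cases hz : ‖z‖ ∈ Ici δ
        · have hz0 : 0 < ‖z‖ := hδ.trans_le hz
          have h6 : K₂ z ^ ((d : ℝ) / (d - 1)) = k' ‖z‖ := by
            simp only [hK₂, indicator_of_mem hz, hk, hk']
            rw [ENNReal.ofReal_rpow_of_pos (by positivity), Real.inv_rpow (by positivity),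
              ← Real.rpow_natCast, ← Real.rpow_mul hz0.le, ← Real.rpow_natCast ‖z‖ d]
            congr 3
            rw [Nat.cast_sub (by omega), Nat.cast_one]
            have : (d : ℝ) - 1 ≠ 0 := by linarith
            field_simp
          rw [h6]
          by_cases hzR : ‖z‖ < R
          · have hzI : ‖z‖ ∈ Ico δ R := ⟨hz, hzR⟩
            rw [indicator_of_mem hzI]
            exact le_self_add
          · refine le_add_left ?_
            refine ENNReal.ofReal_le_ofReal ?_
            have := not_lt.1 hzR
            gcongr
        · simp only [hK₂, indicator_of_notMem hz]
          rw [ENNReal.zero_rpow_of_pos hdp]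
          exact zero_le
      calc ∫⁻ y in Ω, K₂ (x - y) ^ ((d : ℝ) / (d - 1)) ∂μ
          ≤ ∫⁻ y in Ω, ((Ico δ R).indicator k' ‖x - y‖ + ENNReal.ofReal ((R ^ d)⁻¹)) ∂μ :=
            lintegral_mono fun y => h5 _
        _ = ∫⁻ y in Ω, (Ico δ R).indicator k' ‖x - y‖ ∂μ + ENNReal.ofReal ((R ^ d)⁻¹) * μ Ω := by
            rw [lintegral_add_right _ measurable_const, setLIntegral_const]
        _ ≤ ENNReal.ofReal (ω * log (R / δ)) + 1 := by
            refine add_le_add ?_ ?_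
            · refine (setLIntegral_le_lintegral _ _).trans (le_of_eq ?_)
              rw [lintegral_sub_left_eq_self (fun z => (Ico δ R).indicator k' ‖z‖) x,
                lintegral_indicator_annulus_inv_norm_pow μ hδ hδR, hωμ, ENNReal.ofReal_mul hω.le]
            · refine (mul_le_mul_right hR _).trans ?_
              rw [← ENNReal.ofReal_mul (by positivity), inv_mul_cancel₀ (by positivity),
                ENNReal.ofReal_one]
        _ = ENNReal.ofReal (ω * log (R / δ) + 1) := by
            rw [ENNReal.ofReal_add (by positivity) zero_le_one, ENNReal.ofReal_one]
    rw [h1]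
    refine h2.trans ((mul_le_mul' (ENNReal.rpow_le_rpow h4 ?_) h3).trans (le_of_eq ?_))
    · exact (one_div_pos.2 (div_pos (by linarith) (by linarith))).le
    · rw [mul_one, one_div_div, ENNReal.ofReal_rpow_of_nonneg (by positivity)
        (div_nonneg (by linarith) (by linarith))]
  have hpt : ∀ x, ENNReal.ofReal ω * ‖w x‖ₑ ≤ I x + ENNReal.ofReal A := by
    intro x
    have h1 := mul_enorm_le_lintegral_enorm_fderiv μ hw hc x
    rw [hωμ] at h1
    refine h1.trans ?_
    refine le_trans (le_of_eq ?_) (add_le_add_right (hfar x) (I x))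
    rw [hI, ← lintegral_add_left (by fun_prop)]
    refine lintegral_congr fun y => ?_
    rw [← add_mul]
    congr 1
    by_cases h : ‖x - y‖ < δ
    · simp [hK₁, hK₂, hk, h, not_le.2 h, hdef, indicator]
    · simp [hK₁, hK₂, hk, h, not_lt.1 h, hdef, indicator]
  have hsub : {x | 1 + A / ω ≤ |w x|} ⊆ {x | ENNReal.ofReal ω ^ (d : ℝ) ≤ I x ^ (d : ℝ)} := by
    intro x hx
    refine ENNReal.rpow_le_rpow ?_ (by positivity)
    have h1 : ENNReal.ofReal ω + ENNReal.ofReal A ≤ ENNReal.ofReal ω * ‖w x‖ₑ := by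
      rw [← ENNReal.ofReal_add hω.le hA0, ← ofReal_norm, ← ENNReal.ofReal_mul hω.le]
      refine ENNReal.ofReal_le_ofReal ?_
      have hx' : 1 + A / ω ≤ |w x| := hx
      have := mul_le_mul_of_nonneg_left hx' hω.le
      rw [Real.norm_eq_abs]
      field_simp at this
      linarith
    exact (ENNReal.add_le_add_iff_right ENNReal.ofReal_ne_top).1 (h1.trans (hpt x))
  refine (measure_mono hsub).trans ?_
  have hcheb := mul_meas_ge_le_lintegral (μ := μ) (hIm.pow_const (d : ℝ))
    (ENNReal.ofReal ω ^ (d : ℝ))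
  have hyoung := lintegral_rpow_lintegral_sub_mul_le (μ := μ) (p := (d : ℝ)) (by linarith)
    hK₁m hfm.aemeasurable
  have hK₁i : ∫⁻ z, K₁ z ∂μ = ENNReal.ofReal ω * ENNReal.ofReal δ := by
    rw [← hωμ]; exact lintegral_indicator_ball_inv_norm_pow μ δ
  rw [hK₁i, ENNReal.mul_rpow_of_nonneg _ _ (by positivity)] at hyoung
  have h := hcheb.trans (hyoung.trans (mul_le_of_le_one_right' hgrad))
  have hω0 : ENNReal.ofReal ω ^ (d : ℝ) ≠ 0 := by
    simp [hω]
  have hωt : ENNReal.ofReal ω ^ (d : ℝ) ≠ ⊤ :=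
    ENNReal.rpow_ne_top_of_nonneg (by positivity) ENNReal.ofReal_ne_top
  rw [ENNReal.mul_le_mul_iff_right hω0 hωt] at h
  refine h.trans (le_of_eq ?_)
  rw [ENNReal.rpow_natCast, ENNReal.ofReal_pow hδ.le]

/-- A `C¹` soft truncation that kills `[-1, 1]` and has slope at most one. -/
theorem exists_contDiff_softTruncation : ∃ H H' : ℝ → ℝ, ContDiff ℝ 1 H ∧
    (∀ s, HasDerivAt H (H' s) s) ∧ (∀ s, |H' s| ≤ 1) ∧ (∀ s, |s| < 1 → H s = 0 ∧ H' s = 0) ∧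
    ∀ s, |s| - 2 ≤ H s := by
  set h : ℝ → ℝ := fun t => max t 0 ^ 2 / (1 + max t 0) with hh
  set h' : ℝ → ℝ := fun t => 1 - 1 / (1 + max t 0) ^ 2 with hh'
  have hpos : ∀ t : ℝ, 0 < 1 + max t 0 := fun t => by have := le_max_right t 0; linarith
  have hcont : Continuous h := by
    refine Continuous.div (by fun_prop) (by fun_prop) fun t => (hpos t).ne'
  have hcont' : Continuous h' := by
    refine continuous_const.sub (Continuous.div (by fun_prop) (by fun_prop) fun t => ?_)
    exact pow_ne_zero _ (hpos t).ne'
  have hne : ∀ t : ℝ, t ≠ 0 → HasDerivAt h (h' t) t := by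
    intro t ht
    rcases lt_or_gt_of_ne ht with ht | ht
    · have h0 : h' t = 0 := by simp [hh', max_eq_right ht.le]
      rw [h0]
      refine (hasDerivAt_const t (0 : ℝ)).congr_of_eventuallyEq ?_
      filter_upwards [Iio_mem_nhds ht] with s hs
      simp [hh, max_eq_right (mem_Iio.1 hs).le]
    · have h1 : HasDerivAt (fun s : ℝ => s ^ 2 / (1 + s)) (h' t) t := by
        have h1t : 1 + t ≠ 0 := by positivity
        convert! (hasDerivAt_pow 2 t).div ((hasDerivAt_id t).const_add 1) h1t using 1
        simp only [hh', max_eq_left ht.le, id]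
        field_simp
        ring
      refine h1.congr_of_eventuallyEq ?_
      filter_upwards [Ioi_mem_nhds ht] with s hs
      simp [hh, max_eq_left (mem_Ioi.1 hs).le]
  have hder : ∀ t, HasDerivAt h (h' t) t := by
    intro t
    by_cases ht : t = 0
    · subst ht
      exact hasDerivAt_of_hasDerivAt_of_ne hne hcont.continuousAt hcont'.continuousAt
    · exact hne t ht
  have hrange : ∀ t, 0 ≤ h' t ∧ h' t ≤ 1 := by
    intro t
    have h1 : 1 ≤ (1 + max t 0) ^ 2 := one_le_pow₀ (by have := le_max_right t 0; linarith)
    have h2 : 1 / (1 + max t 0) ^ 2 ≤ 1 := (div_le_one (by positivity)).2 h1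
    have h3 : 0 ≤ 1 / (1 + max t 0) ^ 2 := by positivity
    constructor <;> simp only [hh'] <;> linarith
  have hzero : ∀ t ≤ 0, h t = 0 ∧ h' t = 0 := fun t ht => by
    simp [hh, hh', max_eq_right ht]
  have hnn : ∀ t, 0 ≤ h t := fun t => div_nonneg (by positivity) (hpos t).le
  have hlow : ∀ t, t - 1 ≤ h t := by
    intro t
    have h1 : max t 0 - 1 ≤ h t := by
      rw [hh, le_div_iff₀ (hpos t)]
      nlinarith
    linarith [le_max_left t 0]
  have hD : ∀ s, HasDerivAt (fun s => h (s - 1) + h (-s - 1)) (h' (s - 1) - h' (-s - 1)) s := by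
    intro s
    have e1 : HasDerivAt (fun s => h (s - 1)) (h' (s - 1)) s := by
      simpa [Function.comp_def] using (hder (s - 1)).comp s ((hasDerivAt_id s).sub_const 1)
    have e2 : HasDerivAt (fun s => h (-s - 1)) (-h' (-s - 1)) s := by
      simpa [Function.comp_def] using (hder (-s - 1)).comp s ((hasDerivAt_id s).neg.sub_const 1)
    exact (e1.fun_add e2).congr_deriv (by ring)
  refine ⟨fun s => h (s - 1) + h (-s - 1), fun s => h' (s - 1) - h' (-s - 1), ?_, hD, ?_, ?_, ?_⟩
  · rw [contDiff_one_iff_deriv]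
    refine ⟨fun s => (hD s).differentiableAt, ?_⟩
    have : deriv (fun s => h (s - 1) + h (-s - 1)) = fun s => h' (s - 1) - h' (-s - 1) :=
      funext fun s => (hD s).deriv
    rw [this]
    fun_prop
  · intro s
    rw [abs_le]
    have := hrange (s - 1)
    have := hrange (-s - 1)
    constructor <;> linarith
  · intro s hs
    have h1 := hzero (s - 1) (by linarith [(abs_lt.1 hs).2])
    have h2 := hzero (-s - 1) (by linarith [(abs_lt.1 hs).1])
    simp [h1, h2]
  · intro s
    have := hlow (s - 1)
    have := hlow (-s - 1)
    have := hnn (s - 1)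
    have := hnn (-s - 1)
    rcases abs_cases s with ⟨h, _⟩ | ⟨h, _⟩ <;> rw [h] <;> simp only <;> linarith


/-- Exponential decay, at the sharp rate, of the superlevel sets of a function with normalized
gradient, relative to the measure of `{|v| ≥ 1}`. -/
theorem measure_add_three_le_abs_le (hd : 2 ≤ Module.finrank ℝ E) {v : E → ℝ}
    (hv : ContDiff ℝ 1 v) (hc : IsCompact {x | 1 ≤ |v x|})
    (hgrad : ∫⁻ y, ‖fderiv ℝ v y‖ₑ ^ (Module.finrank ℝ E : ℝ) ∂μ ≤ 1)
    {ω : ℝ} (hω : 0 < ω)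
    (hωμ : Module.finrank ℝ E * μ (Metric.ball 0 1) = ENNReal.ofReal ω) {s : ℝ} (hs : 0 ≤ s) :
    μ {x | s + 3 ≤ |v x|} ≤ ENNReal.ofReal (exp (Module.finrank ℝ E / ω -
      Module.finrank ℝ E * ω ^ (1 / ((Module.finrank ℝ E : ℝ) - 1)) *
        s ^ ((Module.finrank ℝ E : ℝ) / ((Module.finrank ℝ E : ℝ) - 1)))) *
      μ {x | 1 ≤ |v x|} := by
  obtain ⟨H, H', hHC, hHd, hH1, hH0, hHlow⟩ := exists_contDiff_softTruncation
  set d := Module.finrank ℝ E with hdef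
  have hd2 : (2 : ℝ) ≤ d := by exact_mod_cast hd
  have hd1 : (d : ℝ) - 1 ≠ 0 := by linarith
  have hd0 : (d : ℝ) ≠ 0 := by linarith
  set Ω := {x | 1 ≤ |v x|} with hΩ
  have hmono : {x | s + 3 ≤ |v x|} ⊆ Ω := fun x hx => by
    have hx' : s + 3 ≤ |v x| := hx
    change 1 ≤ |v x|
    linarith
  set L : ℝ := ω ^ (1 / ((d : ℝ) - 1)) * s ^ ((d : ℝ) / ((d : ℝ) - 1)) - 1 / ω with hL
  have hexp : (d : ℝ) / ω - d * ω ^ (1 / ((d : ℝ) - 1)) * s ^ ((d : ℝ) / ((d : ℝ) - 1)) =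
      -(d * L) := by rw [hL]; ring
  rw [hexp]
  rcases lt_or_ge L 0 with hL0 | hL0
  · have h1 : 1 ≤ ENNReal.ofReal (exp (-(d * L))) := by
      rw [ENNReal.one_le_ofReal]
      exact one_le_exp (by nlinarith)
    calc μ {x | s + 3 ≤ |v x|} ≤ 1 * μ Ω := by rw [one_mul]; exact measure_mono hmono
      _ ≤ _ := mul_le_mul_left h1 _
  by_cases hm : μ Ω = 0
  · rw [hm, mul_zero]
    exact (measure_mono hmono).trans hm.le
  have hmt : μ Ω ≠ ⊤ := hc.measure_lt_top.ne
  set m : ℝ := (μ Ω).toReal with hm_def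
  have hm0 : 0 < m := ENNReal.toReal_pos hm hmt
  set R : ℝ := m ^ (1 / (d : ℝ)) with hRdef
  have hR0 : 0 < R := by positivity
  have hRd : R ^ d = m := by
    rw [← Real.rpow_natCast, hRdef, ← Real.rpow_mul hm0.le, one_div_mul_cancel hd0, Real.rpow_one]
  set δ : ℝ := R * exp (-L) with hδdef
  have hδ0 : 0 < δ := by positivity
  have hδR : δ ≤ R := mul_le_of_le_one_right hR0.le (exp_le_one_iff.2 (by linarith))
  have hlog : log (R / δ) = L := by
    have : R / δ = exp L := by
      rw [hδdef, exp_neg]; field_simp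
    rw [this, log_exp]
  have hwd : ∀ y, HasFDerivAt (H ∘ v) (H' (v y) • fderiv ℝ v y) y := fun y =>
    (hHd (v y)).comp_hasFDerivAt y ((hv.differentiable one_ne_zero).differentiableAt.hasFDerivAt)
  have hmain := measure_le_abs_le μ hd (hHC.comp hv)
    (HasCompactSupport.intro hc fun x hx => (hH0 (v x) (not_le.1 hx)).1)
    (Ω := Ω) hc.measurableSet
    (fun y hy => by rw [(hwd y).fderiv, (hH0 (v y) (not_le.1 hy)).2, zero_smul])
    (by
      refine le_trans (lintegral_mono fun y => ENNReal.rpow_le_rpow ?_ (by positivity)) hgrad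
      rw [(hwd y).fderiv, ← ofReal_norm, ← ofReal_norm, norm_smul]
      refine ENNReal.ofReal_le_ofReal (mul_le_of_le_one_left (norm_nonneg _) (hH1 _)))
    hδ0 hδR (by rw [hRd, hm_def, ENNReal.ofReal_toReal hmt]) hω hωμ
  have hA : (ω * log (R / δ) + 1) ^ (((d : ℝ) - 1) / d) / ω = s := by
    have h1 : ω * log (R / δ) + 1 = (ω * s) ^ ((d : ℝ) / (d - 1)) := by
      have h2 : ω * ω ^ (1 / ((d : ℝ) - 1)) = ω ^ ((d : ℝ) / (d - 1)) := by
        conv_lhs => rw [← Real.rpow_one ω, ← Real.rpow_mul hω.le, ← Real.rpow_add hω]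
        congr 1
        field_simp
        ring
      rw [hlog, hL, Real.mul_rpow hω.le hs, ← h2]
      field_simp
      ring
    rw [h1, ← Real.rpow_mul (by positivity)]
    have : (d : ℝ) / (d - 1) * ((d - 1) / d) = 1 := by field_simp
    rw [this, Real.rpow_one]
    field_simp
  rw [← hdef, hA] at hmain
  refine (measure_mono fun x hx => ?_).trans (hmain.trans (le_of_eq ?_))
  · have hx' : s + 3 ≤ |v x| := hx
    change 1 + s ≤ |(H ∘ v) x|
    have := hHlow (v x)
    refine le_trans ?_ (le_abs_self _)
    simp only [Function.comp]
    linarith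
  · rw [hδdef, mul_pow, hRd, ← exp_nat_mul, mul_comm m, ENNReal.ofReal_mul (exp_pos _).le,
      hm_def, ENNReal.ofReal_toReal hmt]
    congr 3
    ring

theorem summable_exp_rpow_mul_exp_sub {α β p q c : ℝ} (hαβ : α < β) (hp : 1 < p) (hq : 0 ≤ q) :
    Summable fun k : ℕ => exp (α * ((k : ℝ) + 4) ^ p) * ((k : ℝ) + 4) ^ q *
      exp (c - β * (k : ℝ) ^ p) := by
  have hp0 : 0 < p := by linarith
  have t1 : Tendsto (fun x : ℝ => α * (1 + 4 / x) ^ p) atTop (𝓝 (α * (1 + 0) ^ p)) := by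
    refine Tendsto.const_mul _ ?_
    refine Tendsto.rpow_const ?_ (Or.inr hp0.le)
    exact tendsto_const_nhds.add (tendsto_const_nhds.div_atTop tendsto_id)
  have t2 : Tendsto (fun x : ℝ => 2 * q * (log x / x ^ p)) atTop (𝓝 (2 * q * 0)) :=
    ((isLittleO_log_rpow_atTop hp0).tendsto_div_nhds_zero).const_mul _
  have t3 : Tendsto (fun x : ℝ => c / x ^ p) atTop (𝓝 0) :=
    tendsto_const_nhds.div_atTop (tendsto_rpow_atTop hp0)
  have t4 : Tendsto (fun x : ℝ => x ^ (-(p - 1))) atTop (𝓝 0) :=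
    tendsto_rpow_neg_atTop (by linarith)
  have t := ((t1.add t2).add t3).add t4
  simp only [add_zero, Real.one_rpow, mul_one, mul_zero] at t
  have hev := t.eventually_lt_const hαβ
  refine Summable.of_norm_bounded_eventually_nat
    (g := fun k : ℕ => exp (-(k : ℝ))) Real.summable_exp_neg_nat ?_
  filter_upwards [tendsto_natCast_atTop_atTop.eventually hev, eventually_ge_atTop 3] with k hk hk3
  have hk3' : (3 : ℝ) ≤ k := by exact_mod_cast hk3
  have hk0 : (0 : ℝ) < k := by linarith
  have hkp : 0 < (k : ℝ) ^ p := by positivity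
  have hq4 : ((k : ℝ) + 4) ^ q = exp (log ((k : ℝ) + 4) * q) :=
    Real.rpow_def_of_pos (by positivity) q
  rw [Real.norm_of_nonneg (by positivity), hq4, ← exp_add, ← exp_add]
  refine exp_le_exp.2 ?_
  have hlog : log ((k : ℝ) + 4) ≤ 2 * log k := by
    have h2 : 2 * log (k : ℝ) = log ((k : ℝ) ^ 2) := by rw [log_pow]; norm_num
    rw [h2]
    exact log_le_log (by positivity) (by nlinarith)
  have e1 : (1 + 4 / (k : ℝ)) ^ p * (k : ℝ) ^ p = ((k : ℝ) + 4) ^ p := by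
    rw [← Real.mul_rpow (by positivity) hk0.le]
    congr 1
    field_simp
  have e2 : (k : ℝ) ^ (-(p - 1)) * (k : ℝ) ^ p = k := by
    rw [← Real.rpow_add hk0]
    ring_nf
    exact Real.rpow_one _
  have h := mul_lt_mul_of_pos_right hk hkp
  have e3 : (α * (1 + 4 / (k : ℝ)) ^ p + 2 * q * (log k / (k : ℝ) ^ p) + c / (k : ℝ) ^ p +
      (k : ℝ) ^ (-(p - 1))) * (k : ℝ) ^ p =
      α * ((k : ℝ) + 4) ^ p + 2 * q * log k + c + k := by
    rw [add_mul, add_mul, add_mul, mul_assoc α, e1, e2, mul_assoc (2 * q),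
      div_mul_cancel₀ _ hkp.ne', div_mul_cancel₀ _ hkp.ne']
  rw [e3] at h
  nlinarith [mul_le_mul_of_nonneg_right hlog hq]


theorem exists_lintegral_exp_mul_rpow_le_of_contDiff (hd : 2 ≤ Module.finrank ℝ E) {ω α q : ℝ}
    (hω : 0 < ω) (hωμ : Module.finrank ℝ E * μ (Metric.ball 0 1) = ENNReal.ofReal ω)
    (hα0 : 0 ≤ α) (hq : 0 < q)
    (hα : α < Module.finrank ℝ E * ω ^ (1 / ((Module.finrank ℝ E : ℝ) - 1))) :
    ∃ C : ℝ, 0 < C ∧ ∀ v : E → ℝ, ContDiff ℝ 1 v → IsCompact {x | 1 ≤ |v x|} →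
      ∫⁻ y, ‖fderiv ℝ v y‖ₑ ^ (Module.finrank ℝ E : ℝ) ∂μ ≤ 1 →
      ∫⁻ x, ENNReal.ofReal (exp (α * |v x| ^
        ((Module.finrank ℝ E : ℝ) / ((Module.finrank ℝ E : ℝ) - 1))) * |v x| ^ q) ∂μ ≤
      ENNReal.ofReal C * ∫⁻ x, ENNReal.ofReal (|v x| ^ q) ∂μ := by
  set d := Module.finrank ℝ E with hdef
  have hd2 : (2 : ℝ) ≤ d := by exact_mod_cast hd
  set p : ℝ := (d : ℝ) / ((d : ℝ) - 1) with hp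
  set β : ℝ := d * ω ^ (1 / ((d : ℝ) - 1)) with hβ
  have hp1 : 1 < p := by rw [hp, one_lt_div (by linarith)]; linarith
  have hp0 : 0 < p := by linarith
  set c : ℝ := d / ω with hc
  have hc0 : 0 ≤ c := by positivity
  set a : ℕ → ℝ := fun k => exp (α * ((k : ℝ) + 2) ^ p) * ((k : ℝ) + 2) ^ q with ha
  set b : ℕ → ℝ := fun k => exp (c - β * ((k - 2 : ℕ) : ℝ) ^ p) with hb
  have ha0 : ∀ k, 0 ≤ a k := fun k => by positivity
  have hb0 : ∀ k, 0 ≤ b k := fun k => by positivity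
  have hsum : Summable fun k => a k * b k := by
    rw [← summable_nat_add_iff 2]
    refine (summable_exp_rpow_mul_exp_sub (c := c) hα hp1 hq.le).congr fun k => ?_
    simp only [ha, hb, Nat.add_sub_cancel, Nat.cast_add, Nat.cast_ofNat]
    rw [add_assoc]
    norm_num
  have hS0 : 0 ≤ ∑' k, a k * b k := tsum_nonneg fun k => mul_nonneg (ha0 k) (hb0 k)
  refine ⟨exp α + ∑' k, a k * b k, by positivity, fun v hv hcpt hgrad => ?_⟩
  have hvm : Measurable v := hv.continuous.measurable
  set m := μ {x | 1 ≤ |v x|} with hm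
  have hlevel : ∀ k : ℕ, μ {x | (k : ℝ) + 1 ≤ |v x|} ≤ ENNReal.ofReal (b k) * m := by
    intro k
    rcases le_total 2 k with hk | hk
    · obtain ⟨j, rfl⟩ := Nat.exists_eq_add_of_le' hk
      have := measure_add_three_le_abs_le μ hd hv hcpt hgrad hω hωμ (s := (j : ℝ)) (by positivity)
      simp only [hb, Nat.add_sub_cancel, Nat.cast_add, Nat.cast_ofNat]
      convert this using 5
      ring
    · have h1 : 1 ≤ ENNReal.ofReal (b k) := by
        rw [ENNReal.one_le_ofReal]
        simp only [hb, Nat.sub_eq_zero_of_le hk, Nat.cast_zero, Real.zero_rpow hp0.ne', mul_zero,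
          sub_zero]
        exact one_le_exp hc0
      calc μ {x | (k : ℝ) + 1 ≤ |v x|} ≤ 1 * m := by
            rw [one_mul]
            refine measure_mono fun x hx => ?_
            have hx' : (k : ℝ) + 1 ≤ |v x| := hx
            have : (0 : ℝ) ≤ k := by positivity
            change 1 ≤ |v x|
            linarith
        _ ≤ _ := mul_le_mul_left h1 _
  have hmq : m ≤ ∫⁻ x, ENNReal.ofReal (|v x| ^ q) ∂μ := by
    have h1 := mul_meas_ge_le_lintegral (μ := μ)
      (f := fun x => ENNReal.ofReal (|v x| ^ q)) (by fun_prop) 1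
    rw [one_mul] at h1
    refine le_trans (measure_mono fun x hx => ?_) h1
    have hx' : 1 ≤ |v x| := hx
    change 1 ≤ ENNReal.ofReal (|v x| ^ q)
    rw [ENNReal.one_le_ofReal]
    exact Real.one_le_rpow hx' hq.le
  have hpt : ∀ x, ENNReal.ofReal (exp (α * |v x| ^ p) * |v x| ^ q) ≤
      ENNReal.ofReal (exp α) * ENNReal.ofReal (|v x| ^ q) +
      ∑' k : ℕ, ENNReal.ofReal (a k) * {x | (k : ℝ) + 1 ≤ |v x|}.indicator 1 x := by
    intro x
    rcases le_total |v x| 1 with h | h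
    · refine le_add_right ?_
      rw [← ENNReal.ofReal_mul (exp_pos _).le]
      refine ENNReal.ofReal_le_ofReal (mul_le_mul_of_nonneg_right ?_ (by positivity))
      refine exp_le_exp.2 (mul_le_of_le_one_right hα0 (Real.rpow_le_one (abs_nonneg _) h hp0.le))
    · refine le_add_left ?_
      obtain ⟨k, hk⟩ := Nat.exists_eq_add_of_le' ((Nat.one_le_floor_iff _).2 h)
      have h1 : (k : ℝ) + 1 ≤ |v x| := by
        have := Nat.floor_le (abs_nonneg (v x))
        rw [hk] at this
        exact_mod_cast this
      have h2 : |v x| ≤ (k : ℝ) + 2 := by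
        have := (Nat.lt_floor_add_one |v x|).le
        rw [hk] at this
        push_cast at this
        linarith
      refine le_trans ?_ (ENNReal.le_tsum k)
      rw [indicator_of_mem (show x ∈ {x | (k : ℝ) + 1 ≤ |v x|} from h1), Pi.one_apply, mul_one]
      refine ENNReal.ofReal_le_ofReal ?_
      simp only [ha]
      gcongr
  have hmeas : ∀ k : ℕ, MeasurableSet {x | (k : ℝ) + 1 ≤ |v x|} := fun k =>
    measurableSet_le measurable_const (by fun_prop)
  calc ∫⁻ x, ENNReal.ofReal (exp (α * |v x| ^ p) * |v x| ^ q) ∂μ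
      ≤ ∫⁻ x, (ENNReal.ofReal (exp α) * ENNReal.ofReal (|v x| ^ q) +
        ∑' k : ℕ, ENNReal.ofReal (a k) * {x | (k : ℝ) + 1 ≤ |v x|}.indicator 1 x) ∂μ :=
        lintegral_mono hpt
    _ = ENNReal.ofReal (exp α) * ∫⁻ x, ENNReal.ofReal (|v x| ^ q) ∂μ +
        ∑' k : ℕ, ENNReal.ofReal (a k) * μ {x | (k : ℝ) + 1 ≤ |v x|} := by
        rw [lintegral_add_left (by fun_prop), lintegral_const_mul _ (by fun_prop),
          lintegral_tsum fun k =>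
            ((measurable_one.indicator (hmeas k)).const_mul _).aemeasurable]
        congr 2 with k
        rw [lintegral_const_mul _ (measurable_one.indicator (hmeas k)),
          lintegral_indicator_one (hmeas k)]
    _ ≤ ENNReal.ofReal (exp α) * ∫⁻ x, ENNReal.ofReal (|v x| ^ q) ∂μ +
        ∑' k : ℕ, ENNReal.ofReal (a k * b k) * m := by
        refine add_le_add_right (ENNReal.tsum_le_tsum fun k => ?_) _
        rw [ENNReal.ofReal_mul (ha0 k), mul_assoc]
        exact mul_le_mul_right (hlevel k) _
    _ = ENNReal.ofReal (exp α) * ∫⁻ x, ENNReal.ofReal (|v x| ^ q) ∂μ +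
        ENNReal.ofReal (∑' k, a k * b k) * m := by
        rw [ENNReal.tsum_mul_right,
          ENNReal.ofReal_tsum_of_nonneg (fun k => mul_nonneg (ha0 k) (hb0 k)) hsum]
    _ ≤ _ := by
        rw [ENNReal.ofReal_add (exp_pos _).le hS0, add_mul]
        gcongr

end Polar

section Mollification

variable {E : Type*} [NormedAddCommGroup E] [NormedSpace ℝ E] [FiniteDimensional ℝ E]
  [MeasurableSpace E] (μ : Measure E)

theorem enorm_integral_normed_smul_le (φ : ContDiffBump (0 : E)) {F : Type*}
    [NormedAddCommGroup F] [NormedSpace ℝ F] (f : E → F) (x : E) :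
    ‖∫ t, φ.normed μ (x - t) • f t ∂μ‖ₑ ≤
      ∫⁻ t, ENNReal.ofReal (φ.normed μ (x - t)) * ‖f t‖ₑ ∂μ := by
  refine (enorm_integral_le_lintegral_enorm _).trans_eq (lintegral_congr fun t => ?_)
  rw [enorm_smul, Real.enorm_of_nonneg (φ.nonneg_normed _)]

variable [BorelSpace E] [μ.IsAddHaarMeasure]

theorem lintegral_ofReal_normed (φ : ContDiffBump (0 : E)) :
    ∫⁻ x, ENNReal.ofReal (φ.normed μ x) ∂μ = 1 := by
  rw [← ofReal_integral_eq_lintegral_ofReal φ.integrable_normed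
    (Eventually.of_forall φ.nonneg_normed), φ.integral_normed, ENNReal.ofReal_one]

theorem lintegral_enorm_integral_normed_smul_rpow_le (φ : ContDiffBump (0 : E)) {F : Type*}
    [NormedAddCommGroup F] [NormedSpace ℝ F] {f : E → F} (hf : AEStronglyMeasurable f μ)
    {p : ℝ} (hp : 1 < p) :
    ∫⁻ x, ‖∫ t, φ.normed μ (x - t) • f t ∂μ‖ₑ ^ p ∂μ ≤ ∫⁻ x, ‖f x‖ₑ ^ p ∂μ := by
  have hK : Measurable fun z => ENNReal.ofReal (φ.normed μ z) :=
    φ.continuous_normed.measurable.ennreal_ofReal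
  calc _ ≤ ∫⁻ x, (∫⁻ t, ENNReal.ofReal (φ.normed μ (x - t)) * ‖f t‖ₑ ∂μ) ^ p ∂μ := by
        gcongr with x
        exact enorm_integral_normed_smul_le μ φ f x
    _ ≤ _ := lintegral_rpow_lintegral_sub_mul_le hp hK hf.enorm
    _ = _ := by rw [lintegral_ofReal_normed, ENNReal.one_rpow, one_mul]

theorem isCompact_setOf_one_le_abs_convolution_normed (φ : ContDiffBump (0 : E)) {u : E → ℝ}
    (hu : LocallyIntegrable u μ) {p : ℝ} (hp : 1 < p) (hup : ∫⁻ x, ‖u x‖ₑ ^ p ∂μ ≠ ⊤) :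
    IsCompact {x | 1 ≤ |(φ.normed μ ⋆[ContinuousLinearMap.lsmul ℝ ℝ, μ] u) x|} := by
  have hcont : Continuous (φ.normed μ ⋆[ContinuousLinearMap.lsmul ℝ ℝ, μ] u) :=
    φ.hasCompactSupport_normed.continuous_convolution_left _ φ.continuous_normed hu
  have hum : AEMeasurable (fun x => ‖u x‖ₑ) μ := hu.aestronglyMeasurable.enorm
  have : IsFiniteMeasure (μ.withDensity fun x => ‖u x‖ₑ ^ p) := isFiniteMeasure_withDensity hup
  set M := ENNReal.ofReal (1 / μ.real (Metric.closedBall 0 φ.rIn)) with hM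
  have htight := tendsto_measure_compl_closedBall_of_isTightMeasureSet
    (isTightMeasureSet_singleton (μ := μ.withDensity fun x => ‖u x‖ₑ ^ p)) (0 : E)
  simp only [mem_singleton_iff, iSup_iSup_eq_left] at htight
  have hMinv : 0 < M⁻¹ := ENNReal.inv_pos.2 ENNReal.ofReal_ne_top
  obtain ⟨R, hR⟩ := (htight.eventually (gt_mem_nhds hMinv)).exists
  refine Metric.isCompact_of_isClosed_isBounded
    (isClosed_le continuous_const hcont.abs) ?_
  refine (Metric.isBounded_closedBall (x := (0 : E)) (r := R + φ.rOut)).subset fun x hx => ?_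
  by_contra hxR
  rw [mem_closedBall_zero_iff, not_le] at hxR
  refine hR.not_ge ?_
  have hx1 : (1 : ℝ≥0∞) ≤ ‖(φ.normed μ ⋆[ContinuousLinearMap.lsmul ℝ ℝ, μ] u) x‖ₑ := by
    rw [← ofReal_norm, ENNReal.one_le_ofReal]
    exact hx
  have hKm : Measurable fun t => ENNReal.ofReal (φ.normed μ (x - t)) :=
    (φ.continuous_normed.comp (by fun_prop)).measurable.ennreal_ofReal
  have hmain : 1 ≤ M * (μ.withDensity fun x => ‖u x‖ₑ ^ p) (Metric.closedBall 0 R)ᶜ := by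
    calc (1 : ℝ≥0∞) ≤ (∫⁻ t, ENNReal.ofReal (φ.normed μ (x - t)) * ‖u t‖ₑ ∂μ) ^ p := by
          refine ENNReal.one_le_rpow (hx1.trans ?_) (by linarith)
          rw [convolution_lsmul_swap]
          exact enorm_integral_normed_smul_le μ φ u x
      _ ≤ (∫⁻ t, ENNReal.ofReal (φ.normed μ (x - t)) ∂μ) ^ (p - 1) *
            ∫⁻ t, ENNReal.ofReal (φ.normed μ (x - t)) * ‖u t‖ₑ ^ p ∂μ :=
          rpow_lintegral_mul_le hp hKm.aemeasurable hum
      _ = ∫⁻ t, ENNReal.ofReal (φ.normed μ (x - t)) * ‖u t‖ₑ ^ p ∂μ := by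
          rw [lintegral_sub_left_eq_self (fun t => ENNReal.ofReal (φ.normed μ t)),
            lintegral_ofReal_normed, ENNReal.one_rpow, one_mul]
      _ ≤ ∫⁻ t, (Metric.closedBall (0 : E) R)ᶜ.indicator (fun t => M * ‖u t‖ₑ ^ p) t ∂μ := by
          gcongr with t
          by_cases ht : t ∈ (Metric.closedBall (0 : E) R)ᶜ
          · rw [indicator_of_mem ht]
            gcongr
            exact ENNReal.ofReal_le_ofReal (φ.normed_le_div_measure_closedBall_rIn μ _)
          · rw [indicator_of_notMem ht]
            rw [mem_compl_iff, not_not, mem_closedBall_zero_iff] at ht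
            have : φ.normed μ (x - t) = 0 := by
              rw [← Function.notMem_support, φ.support_normed_eq, mem_ball_zero_iff, not_lt]
              linarith [norm_sub_norm_le x t]
            simp [this]
      _ = _ := by
          rw [lintegral_indicator Metric.isClosed_closedBall.measurableSet.compl,
            lintegral_const_mul'' _ (hum.pow_const p).restrict,
            withDensity_apply _ Metric.isClosed_closedBall.measurableSet.compl]
  exact (ENNReal.inv_le_iff_le_mul (fun h => absurd h (measure_ne_top _ _))
    (fun h => absurd h ENNReal.ofReal_ne_top)).2 hmain

end Mollification

theorem fderiv_convolution_normed_eq_innerSL {N : ℕ} {u : EuclideanSpace ℝ (Fin N) → ℝ}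
    {g : EuclideanSpace ℝ (Fin N) → EuclideanSpace ℝ (Fin N)} (hug : HasWeakGradient u g)
    (φ : ContDiffBump (0 : EuclideanSpace ℝ (Fin N))) (x : EuclideanSpace ℝ (Fin N)) :
    fderiv ℝ (φ.normed volume ⋆[ContinuousLinearMap.lsmul ℝ ℝ, volume] u) x =
      innerSL ℝ (∫ t, φ.normed volume (x - t) • g t) := by
  obtain ⟨hu, hg, hweak⟩ := hug
  have hcs : HasCompactSupport (φ.normed volume) := φ.hasCompactSupport_normed
  have hφ : ContDiff ℝ 1 (φ.normed volume) := φ.contDiff_normed (n := 1)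
  rw [(hcs.hasFDerivAt_convolution_left (ContinuousLinearMap.lsmul ℝ ℝ) hφ hu x).fderiv]
  refine ContinuousLinearMap.coe_injective
    ((EuclideanSpace.basisFun (Fin N) ℝ).toBasis.ext fun i => ?_)
  have hψc : HasCompactSupport fun t => φ.normed volume (x - t) :=
    hcs.comp_homeomorph (Homeomorph.subLeft x)
  have hint : Integrable (fun t => φ.normed volume (x - t) • g t) :=
    hg.integrable_smul_left_of_hasCompactSupport (φ.continuous_normed.comp (by fun_prop)) hψc
  have hint' : Integrable fun t => ((ContinuousLinearMap.lsmul ℝ ℝ).precompL _)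
      (fderiv ℝ (φ.normed volume) (x - t)) (u t) :=
    ((hcs.fderiv ℝ).convolutionExists_left _ (hφ.continuous_fderiv one_ne_zero) hu x).integrable_swap
  have hderiv : ∀ t e, fderiv ℝ (fun t => φ.normed volume (x - t)) t e =
      - fderiv ℝ (φ.normed volume) (x - t) e := by
    intro t e
    have h1 : HasFDerivAt (fun t => φ.normed volume (x - t)) _ t :=
      ((hφ.differentiable one_ne_zero (x - t)).hasFDerivAt).comp t
        ((hasFDerivAt_const x t).sub (hasFDerivAt_id t))
    rw [h1.fderiv]
    simp
  have hw := hweak (fun t => φ.normed volume (x - t))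
    (φ.contDiff_normed.comp (contDiff_const.sub contDiff_id)) hψc i
  simp only [hderiv, mul_neg, integral_neg, neg_inj] at hw
  simp only [OrthonormalBasis.coe_toBasis, EuclideanSpace.basisFun_apply,
    ContinuousLinearMap.coe_coe, innerSL_apply_apply]
  rw [convolution_eq_swap, ContinuousLinearMap.integral_apply hint']
  have h2 := (EuclideanSpace.proj i : EuclideanSpace ℝ (Fin N) →L[ℝ] ℝ).integral_comp_comm hint
  simp only [EuclideanSpace.coe_proj, PiLp.smul_apply, smul_eq_mul] at h2
  simp only [EuclideanSpace.inner_single_right, one_mul, RCLike.conj_to_real]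
  rw [← h2]
  simp only [mul_comm (φ.normed volume _)]
  rw [← hw]
  refine integral_congr_ae (Eventually.of_forall fun t => ?_)
  simp [ContinuousLinearMap.precompL_apply, mul_comm]

theorem ofReal_sphereArea (N : ℕ) :
    ENNReal.ofReal (sphereArea N) =
      N * volume (Metric.ball (0 : EuclideanSpace ℝ (Fin N)) 1) := by
  rw [sphereArea, ENNReal.ofReal_mul (Nat.cast_nonneg N), ENNReal.ofReal_natCast,
    ENNReal.ofReal_toReal measure_ball_lt_top.ne]

theorem sphereArea_pos {N : ℕ} (hN : N ≠ 0) : 0 < sphereArea N :=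
  mul_pos (by positivity) (ENNReal.toReal_pos (Metric.measure_ball_pos _ _ one_pos).ne'
    measure_ball_lt_top.ne)

theorem ofReal_norm_rpow_eq {F : Type*} [NormedAddCommGroup F] (z : F) {p : ℝ} (hp : 0 ≤ p) :
    ENNReal.ofReal (‖z‖ ^ p) = ‖z‖ₑ ^ p := by
  rw [← ENNReal.ofReal_rpow_of_nonneg (norm_nonneg z) hp, ofReal_norm]

/-- **Lemma 3.2.** For `2 ≤ N < q` and `0 < α < α_N = N·ω_{N-1}^{1/(N-1)}`, there is
`C = C(N,α,q) > 0` such that for every `u ∈ L^q(ℝ^N) ∩ W^{1,N}(ℝ^N)` with `∫|∇u|^N ≤ 1`,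
`∫ e^{α|u|^{N/(N-1)}}|u|^q dx ≤ C ∫ |u|^q dx`. -/
theorem moser_trudinger_exp_pow_nonsingular (N : ℕ) (hN : 2 ≤ N) (q : ℝ) (hq : (N : ℝ) < q)
    (α : ℝ) (hα0 : 0 < α) (hα : α < (N : ℝ) * sphereArea N ^ (1 / ((N : ℝ) - 1))) :
    ∃ C : ℝ, 0 < C ∧
      ∀ (u : EuclideanSpace ℝ (Fin N) → ℝ)
        (g : EuclideanSpace ℝ (Fin N) → EuclideanSpace ℝ (Fin N)),
        HasWeakGradient u g →
        (∫⁻ x, ENNReal.ofReal (|u x| ^ (N : ℝ))) ≠ ⊤ →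
        (∫⁻ x, ENNReal.ofReal (|u x| ^ q)) ≠ ⊤ →
        (∫⁻ x, ENNReal.ofReal (‖g x‖ ^ (N : ℝ))) ≤ 1 →
        (∫⁻ x, ENNReal.ofReal
            (Real.exp (α * |u x| ^ ((N : ℝ) / ((N : ℝ) - 1))) * |u x| ^ q))
          ≤ ENNReal.ofReal C * ∫⁻ x, ENNReal.ofReal (|u x| ^ q) := by
  have hN2 : (2 : ℝ) ≤ N := by exact_mod_cast hN
  have hN0 : N ≠ 0 := by omega
  have hq0 : 0 < q := by linarith
  have : Nonempty (Fin N) := ⟨⟨0, by omega⟩⟩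
  have hp0 : 0 ≤ (N : ℝ) / ((N : ℝ) - 1) := div_nonneg (by linarith) (by linarith)
  have key := exists_lintegral_exp_mul_rpow_le_of_contDiff
    (volume : Measure (EuclideanSpace ℝ (Fin N))) (by rwa [finrank_euclideanSpace_fin])
    (sphereArea_pos hN0) (by rw [finrank_euclideanSpace_fin, ofReal_sphereArea]) hα0.le hq0
    (by rwa [finrank_euclideanSpace_fin])
  rw [finrank_euclideanSpace_fin] at key
  obtain ⟨C, hC0, hC⟩ := key
  refine ⟨C, hC0, fun u g hug huN _ hgN => ?_⟩
  have hu := hug.1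
  simp only [← Real.norm_eq_abs, ofReal_norm_rpow_eq _ (Nat.cast_nonneg N)] at huN
  simp only [ofReal_norm_rpow_eq _ (Nat.cast_nonneg N)] at hgN
  let φ : ℕ → ContDiffBump (0 : EuclideanSpace ℝ (Fin N)) := fun n =>
    { rIn := 1 / ((n : ℝ) + 1)
      rOut := 2 * (1 / ((n : ℝ) + 1))
      rIn_pos := Nat.one_div_pos_of_nat
      rIn_lt_rOut := by linarith [Nat.one_div_pos_of_nat (α := ℝ) (n := n)] }
  let v : ℕ → EuclideanSpace ℝ (Fin N) → ℝ := fun n =>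
    (φ n).normed volume ⋆[ContinuousLinearMap.lsmul ℝ ℝ, volume] u
  have hlim : ∀ᵐ x, Tendsto (fun n => v n x) atTop (𝓝 (u x)) := by
    refine ContDiffBump.ae_convolution_tendsto_right_of_locallyIntegrable (K := 2) ?_
      (Eventually.of_forall fun n => le_rfl) hu
    simpa only [mul_zero] using
      (tendsto_one_div_add_atTop_nhds_zero_nat (𝕜 := ℝ)).const_mul (2 : ℝ)
  have hvsm : ∀ n, ContDiff ℝ 1 (v n) := fun n =>
    (φ n).hasCompactSupport_normed.contDiff_convolution_left _
      ((φ n).contDiff_normed (n := 1)) hu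
  have hvq : ∀ n, ∫⁻ x, ENNReal.ofReal (|v n x| ^ q) ≤ ∫⁻ x, ENNReal.ofReal (|u x| ^ q) := by
    intro n
    simp only [← Real.norm_eq_abs, ofReal_norm_rpow_eq _ hq0.le, v, convolution_lsmul_swap]
    exact lintegral_enorm_integral_normed_smul_rpow_le volume (φ n) hu.aestronglyMeasurable
      (by linarith)
  have hvg : ∀ n, ∫⁻ x, ‖fderiv ℝ (v n) x‖ₑ ^ (N : ℝ) ≤ 1 := by
    intro n
    refine le_trans (le_of_eq ?_) ((lintegral_enorm_integral_normed_smul_rpow_le volume (φ n)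
      hug.2.1.aestronglyMeasurable (p := N) (by linarith)).trans hgN)
    refine lintegral_congr fun x => ?_
    rw [fderiv_convolution_normed_eq_innerSL hug, ← ofReal_norm, innerSL_apply_norm, ofReal_norm]
  have hvcpt : ∀ n, IsCompact {x | 1 ≤ |v n x|} := fun n =>
    isCompact_setOf_one_le_abs_convolution_normed volume (φ n) hu (p := N) (by linarith) huN
  let Ψ : ℝ → ℝ≥0∞ := fun s =>
    ENNReal.ofReal (exp (α * |s| ^ ((N : ℝ) / ((N : ℝ) - 1))) * |s| ^ q)
  have hΨ : Continuous Ψ := by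
    refine ENNReal.continuous_ofReal.comp (Continuous.mul ?_ ?_)
    · exact continuous_exp.comp
        (continuous_const.mul (continuous_abs.rpow_const fun _ => Or.inr hp0))
    · exact continuous_abs.rpow_const fun _ => Or.inr hq0.le
  calc ∫⁻ x, Ψ (u x) = ∫⁻ x, liminf (fun n => Ψ (v n x)) atTop := by
        refine lintegral_congr_ae ?_
        filter_upwards [hlim] with x hx
        exact (((hΨ.tendsto _).comp hx).liminf_eq).symm
    _ ≤ liminf (fun n => ∫⁻ x, Ψ (v n x)) atTop :=
        lintegral_liminf_le fun n => (hΨ.comp (hvsm n).continuous).measurable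
    _ ≤ ENNReal.ofReal C * ∫⁻ x, ENNReal.ofReal (|u x| ^ q) := by
        refine liminf_le_of_le (by isBoundedDefault) fun b hb => ?_
        obtain ⟨n, hn⟩ := hb.exists
        refine hn.trans ((hC (v n) (hvsm n) (hvcpt n) (hvg n)).trans ?_)
        exact mul_le_mul_right (hvq n) _
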